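/- arXiv:math/0507177 — 4 statements merged into one kernel-verified Lean document; each statement's English description precedes it below -/
import Mathlib

section
/- Let R be a commutative local ring and let (M₁, B₁) and (M₂, B₂) be two finite free R-modules of the same rank, each equipped with a perfect alternating bilinear form. Then there exists an R-linear isomorphism α : M₁ → M₂ which is an isometry, i.e. B₂(α(x), α(y)) = B₁(x, y) for all x, y ∈ M₁. -/
namespace LinearMap

variable {R M : Type*} [CommRing R] [AddCommGroup M] [Module R M]

/-- A perfect alternating form on a nontrivial free module admits a hyperbolic pair. -/
theorem exists_apply_eq_one_of_surjective [Nontrivial R] [Nontrivial M] [Module.Free R M]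
    (B : M →ₗ[R] M →ₗ[R] R) (hsurj : Function.Surjective B) : ∃ e f, B e f = 1 := by
  let b := Module.Free.chooseBasis R M
  obtain ⟨i⟩ := b.index_nonempty
  obtain ⟨e, he⟩ := hsurj (b.coord i)
  exact ⟨e, b i, by simp [he]⟩

/-- The orthogonal complement of the plane spanned by `e` and `f`. -/
def pairComplement (B : M →ₗ[R] M →ₗ[R] R) (e f : M) : Submodule R M :=
  ker (B e) ⊓ ker (B f)

theorem mem_pairComplement {B : M →ₗ[R] M →ₗ[R] R} {e f x : M} :
    x ∈ B.pairComplement e f ↔ B e x = 0 ∧ B f x = 0 := by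
  simp [pairComplement]

/-- The projection onto the orthogonal complement of a hyperbolic pair. -/
def pairProjection (B : M →ₗ[R] M →ₗ[R] R) (hB : B.IsAlt) {e f : M} (hef : B e f = 1) :
    M →ₗ[R] B.pairComplement e f :=
  (LinearMap.id + (B f).smulRight e - (B e).smulRight f).codRestrict _ fun x => by
    have hfe : B f e = -1 := by rw [← hB.neg, hef]
    simp [mem_pairComplement, hB.self_eq_zero, hef, hfe]

theorem coe_pairProjection (B : M →ₗ[R] M →ₗ[R] R) (hB : B.IsAlt) {e f : M} (hef : B e f = 1)
    (x : M) : (B.pairProjection hB hef x : M) = x + B f x • e - B e x • f := rfl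

/-- A hyperbolic pair splits off its orthogonal complement. -/
def pairSplitting (B : M →ₗ[R] M →ₗ[R] R) (hB : B.IsAlt) {e f : M} (hef : B e f = 1) :
    ((R × R) × B.pairComplement e f) ≃ₗ[R] M :=
  LinearEquiv.ofLinearMap
    (((toSpanSingleton R M e).coprod (toSpanSingleton R M f)).coprod
      (B.pairComplement e f).subtype)
    (((-B f).prod (B e)).prod (B.pairProjection hB hef))
    (by
      ext x
      simp [coe_pairProjection])
    (by
      have hfe : B f e = -1 := by rw [← hB.neg, hef]
      refine LinearMap.ext fun ⟨⟨a, b⟩, w, hw⟩ => ?_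
      have h := mem_pairComplement.1 hw
      simp [Prod.ext_iff, Subtype.ext_iff, coe_pairProjection, hB.self_eq_zero, hef, hfe, h.1, h.2])

theorem pairSplitting_apply (B : M →ₗ[R] M →ₗ[R] R) (hB : B.IsAlt) {e f : M} (hef : B e f = 1)
    (a b : R) (w : B.pairComplement e f) :
    B.pairSplitting hB hef ((a, b), w) = a • e + b • f + (w : M) := by
  simp [pairSplitting]

theorem apply_pairSplitting (B : M →ₗ[R] M →ₗ[R] R) (hB : B.IsAlt) {e f : M} (hef : B e f = 1)
    (p q : (R × R) × B.pairComplement e f) :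
    B (B.pairSplitting hB hef p) (B.pairSplitting hB hef q) =
      p.1.1 * q.1.2 - p.1.2 * q.1.1 + B p.2 q.2 := by
  obtain ⟨⟨a, b⟩, w, hw⟩ := p
  obtain ⟨⟨c, d⟩, w', hw'⟩ := q
  have hfe : B f e = -1 := by rw [← hB.neg, hef]
  have h := mem_pairComplement.1 hw
  have h' := mem_pairComplement.1 hw'
  have hwe : B w e = 0 := by rw [← hB.neg, h.1, neg_zero]
  have hwf : B w f = 0 := by rw [← hB.neg, h.2, neg_zero]
  simp [pairSplitting_apply, hB.self_eq_zero, hef, hfe, h'.1, h'.2, hwe, hwf]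
  ring

/-- A perfect alternating form restricts to a perfect form on the complement of a
hyperbolic pair. -/
theorem bijective_domRestrict₁₂_pairComplement (B : M →ₗ[R] M →ₗ[R] R) (hB : B.IsAlt) {e f : M}
    (hef : B e f = 1) (hbij : Function.Bijective B) :
    Function.Bijective
      (B.domRestrict₁₂ (B.pairComplement e f) (B.pairComplement e f)) := by
  have hfe : B f e = -1 := by rw [← hB.neg, hef]
  constructor
  · rw [injective_iff_map_eq_zero]
    intro w hw
    have h := mem_pairComplement.1 w.2
    have hwe : B w e = 0 := by rw [← hB.neg, h.1, neg_zero]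
    have hwf : B w f = 0 := by rw [← hB.neg, h.2, neg_zero]
    refine Subtype.ext (hbij.1 ?_)
    ext x
    have hx := LinearMap.congr_fun hw (B.pairProjection hB hef x)
    rw [domRestrict₁₂_apply] at hx
    simpa [coe_pairProjection, hwe, hwf] using hx
  · intro φ
    obtain ⟨m, hm⟩ := hbij.2 (φ ∘ₗ B.pairProjection hB hef)
    have he : B.pairProjection hB hef e = 0 :=
      Subtype.ext (by simp [coe_pairProjection, hB.self_eq_zero, hfe])
    have hf : B.pairProjection hB hef f = 0 :=
      Subtype.ext (by simp [coe_pairProjection, hB.self_eq_zero, hef])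
    refine ⟨⟨m, mem_pairComplement.2 ⟨?_, ?_⟩⟩, ?_⟩
    · rw [← hB.neg, hm]; simp [he]
    · rw [← hB.neg, hm]; simp [hf]
    · ext w
      have h := mem_pairComplement.1 w.2
      have hw : B.pairProjection hB hef w = w :=
        Subtype.ext (by simp [coe_pairProjection, h.1, h.2])
      rw [domRestrict₁₂_apply, hm, comp_apply, hw]

section Complement

variable [Module.Finite R M]

theorem finite_pairComplement (B : M →ₗ[R] M →ₗ[R] R) (hB : B.IsAlt) {e f : M}
    (hef : B e f = 1) : Module.Finite R (B.pairComplement e f) :=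
  Module.Finite.of_surjective
    (LinearMap.snd R (R × R) _ ∘ₗ (B.pairSplitting hB hef).symm.toLinearMap)
    (Prod.snd_surjective.comp (B.pairSplitting hB hef).symm.surjective)

variable [IsLocalRing R] [Module.Free R M]

theorem free_pairComplement (B : M →ₗ[R] M →ₗ[R] R) (hB : B.IsAlt) {e f : M}
    (hef : B e f = 1) : Module.Free R (B.pairComplement e f) := by
  have := B.finite_pairComplement hB hef
  have : Module.Projective R (B.pairComplement e f) :=
    Module.Projective.of_split
      ((B.pairSplitting hB hef).toLinearMap ∘ₗ LinearMap.inr R (R × R) _)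
      (LinearMap.snd R (R × R) _ ∘ₗ (B.pairSplitting hB hef).symm.toLinearMap)
      (by ext; simp)
  exact Module.free_of_flat_of_isLocalRing

theorem finrank_pairComplement_add_two (B : M →ₗ[R] M →ₗ[R] R) (hB : B.IsAlt) {e f : M}
    (hef : B e f = 1) :
    Module.finrank R (B.pairComplement e f) + 2 = Module.finrank R M := by
  have := B.finite_pairComplement hB hef
  have := B.free_pairComplement hB hef
  rw [← (B.pairSplitting hB hef).finrank_eq]
  simp [add_comm]

end Complement

end LinearMap

/-- Let `R` be a commutative local ring and `(M₁, B₁)`, `(M₂, B₂)` two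
finite free `R`-modules of the same rank, each equipped with a perfect alternating bilinear
form. Then there exists an `R`-linear isometry `α : M₁ ≃ M₂`. -/
theorem flatness_stmt_2 (R : Type*) [CommRing R] [IsLocalRing R]
    (M₁ M₂ : Type*) [AddCommGroup M₁] [Module R M₁] [AddCommGroup M₂] [Module R M₂]
    [Module.Free R M₁] [Module.Finite R M₁] [Module.Free R M₂] [Module.Finite R M₂]
    (hrank : Module.finrank R M₁ = Module.finrank R M₂)
    (B₁ : M₁ →ₗ[R] M₁ →ₗ[R] R) (B₂ : M₂ →ₗ[R] M₂ →ₗ[R] R)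
    (halt₁ : ∀ x, B₁ x x = 0) (halt₂ : ∀ x, B₂ x x = 0)
    (hperf₁ : Function.Bijective B₁) (hperf₂ : Function.Bijective B₂) :
    ∃ α : M₁ ≃ₗ[R] M₂, ∀ x y, B₂ (α x) (α y) = B₁ x y := by
  induction hn : Module.finrank R M₁ using Nat.strong_induction_on generalizing M₁ M₂ with
  | _ n ih =>
  rcases subsingleton_or_nontrivial M₁ with h₁ | h₁
  · refine ⟨LinearEquiv.ofFinrankEq M₁ M₂ hrank, fun x y => ?_⟩
    simp [Subsingleton.elim x 0]
  · have h₂ : Nontrivial M₂ := (LinearEquiv.ofFinrankEq M₁ M₂ hrank).symm.toEquiv.nontrivial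
    have hB₁ : B₁.IsAlt := halt₁
    have hB₂ : B₂.IsAlt := halt₂
    obtain ⟨e₁, f₁, hef₁⟩ := B₁.exists_apply_eq_one_of_surjective hperf₁.2
    obtain ⟨e₂, f₂, hef₂⟩ := B₂.exists_apply_eq_one_of_surjective hperf₂.2
    have := B₁.finite_pairComplement hB₁ hef₁
    have := B₁.free_pairComplement hB₁ hef₁
    have := B₂.finite_pairComplement hB₂ hef₂
    have := B₂.free_pairComplement hB₂ hef₂
    have hr₁ := B₁.finrank_pairComplement_add_two hB₁ hef₁
    have hr₂ := B₂.finrank_pairComplement_add_two hB₂ hef₂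
    obtain ⟨β, hβ⟩ := ih _ (by omega) (B₁.pairComplement e₁ f₁) (B₂.pairComplement e₂ f₂)
      (by omega) (B₁.domRestrict₁₂ _ _) (B₂.domRestrict₁₂ _ _)
      (fun x => halt₁ x) (fun x => halt₂ x)
      (B₁.bijective_domRestrict₁₂_pairComplement hB₁ hef₁ hperf₁)
      (B₂.bijective_domRestrict₁₂_pairComplement hB₂ hef₂ hperf₂) rfl
    refine ⟨(B₁.pairSplitting hB₁ hef₁).symm ≪≫ₗ
      (LinearEquiv.refl R (R × R)).prodCongr β ≪≫ₗ B₂.pairSplitting hB₂ hef₂, fun x y => ?_⟩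
    obtain ⟨p, rfl⟩ := (B₁.pairSplitting hB₁ hef₁).surjective x
    obtain ⟨q, rfl⟩ := (B₁.pairSplitting hB₁ hef₁).surjective y
    have h := hβ p.2 q.2
    simp only [LinearMap.domRestrict₁₂_apply] at h
    simp [LinearMap.apply_pairSplitting, h]
end

section
/- Let R be a commutative ring and I ⊆ R an ideal with I² = 0. Let (M₁, B₁) and (M₂, B₂) be two finite free R-modules of the same rank, each equipped with a perfect alternating bilinear form. Then every R/I-linear isometry ᾱ : M₁/IM₁ → M₂/IM₂ (with respect to the forms induced by B₁ and B₂) lifts to an R-linear isometry α : M₁ → M₂, i.e. α is an R-linear isomorphism with B₂(α(x), α(y)) = B₁(x, y) for all x, y ∈ M₁, whose reduction modulo I equals ᾱ. (This is the infinitesimal lifting criterion expressing that the scheme of symplectic isomorphisms is smooth.) -/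
open Module in
/-- An alternating bilinear form with values in an ideal `I` on a finite free module is the
antisymmetrization of a bilinear form with values in `I`. -/
theorem exists_sub_flip_eq_of_isAlt {R M : Type*} [CommRing R] [AddCommGroup M] [Module R M]
    [Module.Free R M] [Module.Finite R M] (I : Ideal R) (D : M →ₗ[R] M →ₗ[R] R)
    (hD : D.IsAlt) (hDI : ∀ x y, D x y ∈ I) :
    ∃ E : M →ₗ[R] M →ₗ[R] R, (∀ x y, E x y ∈ I) ∧ ∀ x y, E x y - E y x = D x y := by
  classical
  let b := (Free.chooseBasis R M).reindex (Fintype.equivFin _)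
  let E : M →ₗ[R] M →ₗ[R] R :=
    b.constr R fun i => b.constr R fun j => if i < j then D (b i) (b j) else 0
  have hE : ∀ i j, E (b i) (b j) = if i < j then D (b i) (b j) else 0 := fun i j => by
    simp only [E, Basis.constr_basis]
  refine ⟨E, fun x y => ?_, fun x y => ?_⟩
  · simp only [E, Basis.constr_apply_fintype, LinearMap.sum_apply, LinearMap.smul_apply,
      smul_eq_mul]
    refine I.sum_mem fun i _ => I.mul_mem_left _ (I.sum_mem fun j _ => I.mul_mem_left _ ?_)
    split_ifs
    exacts [hDI _ _, I.zero_mem]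
  · have h : E - E.flip = D := by
      refine b.ext fun i => b.ext fun j => ?_
      simp only [LinearMap.sub_apply, LinearMap.flip_apply, hE]
      rcases lt_trichotomy i j with hij | rfl | hij
      · simp [hij, hij.not_gt]
      · simp [hD (b i)]
      · simp [hij, hij.not_gt, hD.neg]
    simpa using LinearMap.congr_fun₂ h x y

/-- A linear functional with values in an ideal `I` on a finite free module lies in
`I • Dual R M`. -/
theorem mem_smul_top_dual_of_forall_mem {R M : Type*} [CommRing R] [AddCommGroup M] [Module R M]
    [Module.Free R M] [Module.Finite R M] (I : Ideal R) (φ : M →ₗ[R] R) (hφ : ∀ x, φ x ∈ I) :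
    φ ∈ (I • ⊤ : Submodule R (M →ₗ[R] R)) := by
  classical
  let b := Module.Free.chooseBasis R M
  have h : φ = ∑ i, φ (b i) • b.coord i := by
    refine b.ext fun j => ?_
    simp
  rw [h]
  exact Submodule.sum_mem _ fun i _ => Submodule.smul_mem_smul (hφ _) trivial

/-- A linear functional with values in `I` maps `I • M` into `I ^ 2`. -/
theorem apply_mem_sq_of_mem_smul_top {R M : Type*} [CommRing R] [AddCommGroup M] [Module R M]
    (I : Ideal R) (φ : M →ₗ[R] R) (hφ : ∀ x, φ x ∈ I) {v : M}
    (hv : v ∈ (I • ⊤ : Submodule R M)) : φ v ∈ I ^ 2 := by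
  induction hv using Submodule.smul_induction_on' with
  | smul r hr n _ =>
    rw [map_smul, smul_eq_mul, sq]
    exact Ideal.mul_mem_mul hr (hφ n)
  | add x _ y _ hx hy => rw [map_add]; exact add_mem hx hy

/-- Modulo a nilpotent ideal, surjectivity onto a finite module lifts. -/
theorem surjective_of_surjective_mod {R M N : Type*} [CommRing R] [AddCommGroup M] [Module R M]
    [AddCommGroup N] [Module R N] [Module.Finite R N] (I : Ideal R) (hI : IsNilpotent I)
    (f : M →ₗ[R] N)
    (hf : Function.Surjective ((I • ⊤ : Submodule R N).mkQ ∘ₗ f)) : Function.Surjective f := by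
  have hJ : I ≤ Ideal.jacobson ⊥ := by
    obtain ⟨n, hn⟩ := hI
    refine le_trans (fun x hx => ?_) Ideal.radical_le_jacobson
    exact ⟨n, hn.le (Ideal.pow_mem_pow hx n)⟩
  rw [← LinearMap.range_eq_top, ← top_le_iff]
  refine Submodule.le_of_le_smul_of_le_jacobson_bot Module.Finite.fg_top hJ fun y _ => ?_
  obtain ⟨x, hx⟩ := hf (Submodule.Quotient.mk y)
  have hxy : y - f x ∈ (I • ⊤ : Submodule R N) := (Submodule.Quotient.eq _).1 hx.symm
  exact Submodule.mem_sup.2 ⟨f x, ⟨x, rfl⟩, y - f x, hxy, add_sub_cancel _ _⟩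

/-- Modulo a nilpotent ideal, a lift of an isomorphism between finite modules is an isomorphism
if the target is projective. -/
theorem bijective_of_lifts_equiv_mod {R M N : Type*} [CommRing R] [AddCommGroup M] [Module R M]
    [AddCommGroup N] [Module R N] [Module.Finite R M] [Module.Finite R N] [Module.Projective R N]
    (I : Ideal R) (hI : IsNilpotent I)
    (e : (M ⧸ (I • ⊤ : Submodule R M)) ≃ₗ[R] (N ⧸ (I • ⊤ : Submodule R N))) (f : M →ₗ[R] N)
    (hf : ∀ x, e (Submodule.Quotient.mk x) = Submodule.Quotient.mk (f x)) :
    Function.Bijective f := by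
  obtain ⟨g, hg⟩ := Module.projective_lifting_property (I • ⊤ : Submodule R M).mkQ
    (e.symm.toLinearMap ∘ₗ (I • ⊤ : Submodule R N).mkQ) (Submodule.mkQ_surjective _)
  have hg' : ∀ y, (Submodule.Quotient.mk (g y) : M ⧸ (I • ⊤ : Submodule R M)) =
      e.symm (Submodule.Quotient.mk y) := LinearMap.congr_fun hg
  constructor
  · have hgf : Function.Surjective (g ∘ₗ f) := by
      refine surjective_of_surjective_mod I hI _ fun z => ?_
      obtain ⟨x, rfl⟩ := Submodule.Quotient.mk_surjective _ z
      refine ⟨x, ?_⟩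
      simp [hg', ← hf]
    have hinj := OrzechProperty.injective_of_surjective_endomorphism _ hgf
    rw [LinearMap.coe_comp] at hinj
    exact hinj.of_comp
  · refine surjective_of_surjective_mod I hI _ fun z => ?_
    obtain ⟨w, rfl⟩ := e.surjective z
    obtain ⟨x, rfl⟩ := Submodule.Quotient.mk_surjective _ w
    exact ⟨x, (hf x).symm⟩

/-- Let `R` be a commutative ring and `I ⊆ R` an ideal with `I² = 0`.
Let `(M₁, B₁)` and `(M₂, B₂)` be two finite free `R`-modules of the same rank, each equipped
with a perfect alternating bilinear form. Then every `R/I`-linear isometry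
`ᾱ : M₁/IM₁ ≃ M₂/IM₂` (with respect to the induced forms) lifts to an `R`-linear isometry
`α : M₁ ≃ M₂` whose reduction modulo `I` is `ᾱ`. -/
theorem flatness_stmt_3 (R : Type*) [CommRing R] (I : Ideal R) (hI : I ^ 2 = ⊥)
    (M₁ M₂ : Type*) [AddCommGroup M₁] [Module R M₁] [AddCommGroup M₂] [Module R M₂]
    [Module.Free R M₁] [Module.Finite R M₁] [Module.Free R M₂] [Module.Finite R M₂]
    (hrank : Module.finrank R M₁ = Module.finrank R M₂)
    (B₁ : M₁ →ₗ[R] M₁ →ₗ[R] R) (B₂ : M₂ →ₗ[R] M₂ →ₗ[R] R)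
    (halt₁ : ∀ x, B₁ x x = 0) (halt₂ : ∀ x, B₂ x x = 0)
    (hperf₁ : Function.Bijective B₁) (hperf₂ : Function.Bijective B₂)
    (ᾱ : (M₁ ⧸ (I • ⊤ : Submodule R M₁)) ≃ₗ[R] (M₂ ⧸ (I • ⊤ : Submodule R M₂)))
    -- `ᾱ` is an isometry for the forms induced by `B₁` and `B₂` on the reductions mod `I`:
    (hiso : ∀ (x y : M₁) (x' y' : M₂),
      ᾱ (Submodule.Quotient.mk x) = Submodule.Quotient.mk x' →
      ᾱ (Submodule.Quotient.mk y) = Submodule.Quotient.mk y' →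
      B₂ x' y' - B₁ x y ∈ I) :
    ∃ α : M₁ ≃ₗ[R] M₂, (∀ x y, B₂ (α x) (α y) = B₁ x y) ∧
      ∀ x : M₁, ᾱ (Submodule.Quotient.mk x) = Submodule.Quotient.mk (α x) := by
  have hnil : IsNilpotent I := ⟨2, hI⟩
  obtain ⟨β, hβ'⟩ := Module.projective_lifting_property (I • ⊤ : Submodule R M₂).mkQ
    (ᾱ.toLinearMap ∘ₗ (I • ⊤ : Submodule R M₁).mkQ) (Submodule.mkQ_surjective _)
  have hβ : ∀ x, ᾱ (Submodule.Quotient.mk x) = Submodule.Quotient.mk (β x) := fun x =>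
    (LinearMap.congr_fun hβ' x).symm
  let e := LinearEquiv.ofBijective β (bijective_of_lifts_equiv_mod I hnil ᾱ β hβ)
  let b₂ := LinearEquiv.ofBijective B₂ hperf₂
  obtain ⟨E, hEI, hE⟩ := exists_sub_flip_eq_of_isAlt I (B₁ - B₂.compl₁₂ β β)
    (fun x => by simp [halt₁, halt₂])
    (fun x y => by
      rw [← neg_mem_iff]
      simpa using hiso x y _ _ (hβ x) (hβ y))
  let δ : M₁ →ₗ[R] M₂ := b₂.symm.toLinearMap ∘ₗ E.compl₂ e.symm.toLinearMap
  have hδ : ∀ x z, B₂ (δ x) z = E x (e.symm z) := fun x z =>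
    LinearMap.congr_fun (b₂.apply_symm_apply (E.compl₂ e.symm.toLinearMap x)) z
  have hδβ : ∀ x y, B₂ (δ x) (β y) = E x y := fun x y =>
    (hδ x (β y)).trans (congrArg (E x) (e.symm_apply_apply y))
  have hδI : ∀ x z, B₂ (δ x) z ∈ I := fun x z => hδ x z ▸ hEI _ _
  have hδmem : ∀ x, δ x ∈ (I • ⊤ : Submodule R M₂) := fun x => by
    have h := Submodule.mem_map_of_mem (f := b₂.symm.toLinearMap)
      (mem_smul_top_dual_of_forall_mem I (B₂ (δ x)) (hδI x))
    rw [Submodule.map_smul''] at h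
    have hx : b₂.symm (B₂ (δ x)) = δ x := b₂.symm_apply_apply (δ x)
    exact Submodule.smul_mono le_rfl le_top (hx ▸ h)
  have hδδ : ∀ x y, B₂ (δ x) (δ y) = 0 := fun x y => by
    simpa [hI] using apply_mem_sq_of_mem_smul_top I _ (hδI x) (hδmem y)
  have hγ : ∀ x, ᾱ (Submodule.Quotient.mk x) = Submodule.Quotient.mk ((β + δ) x) := fun x => by
    rw [hβ, eq_comm, Submodule.Quotient.eq]
    simpa using hδmem x
  refine ⟨LinearEquiv.ofBijective (β + δ) (bijective_of_lifts_equiv_mod I hnil ᾱ _ hγ),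
    fun x y => ?_, hγ⟩
  have hskew : B₂ (β x) (δ y) = -E y x := by
    rw [← hδβ, LinearMap.IsAlt.neg halt₂]
  have hxy := hE x y
  simp only [LinearMap.sub_apply, LinearMap.compl₁₂_apply] at hxy
  simp only [LinearEquiv.ofBijective_apply, LinearMap.add_apply, map_add, hδδ, hδβ, hskew]
  linear_combination hxy
end

section
/- Let R be a commutative noetherian ring, M a finite free R-module, and N ⊆ M a submodule. Then N is a direct summand of M if and only if for every maximal ideal 𝔪 of R the induced map N ⊗_R R/𝔪 → M ⊗_R R/𝔪 is injective. -/
open TensorProduct in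
/-- Base change to an intermediate algebra `A` does not affect injectivity after tensoring with an
`A`-algebra `B`. -/
theorem lTensor_baseChange_injective {R M N : Type*} [CommRing R] [AddCommGroup M] [Module R M]
    [AddCommGroup N] [Module R N] (A B : Type*) [CommRing A] [Algebra R A] [CommRing B]
    [Algebra A B] [Algebra R B] [IsScalarTower R A B] (f : N →ₗ[R] M)
    (hf : Function.Injective (f.lTensor B)) :
    Function.Injective ((f.baseChange A).lTensor B) := by
  let eN := AlgebraTensorModule.cancelBaseChange R A A B N
  let eM := AlgebraTensorModule.cancelBaseChange R A A B M
  have comm (x : B ⊗[A] (A ⊗[R] N)) :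
      eM ((f.baseChange A).lTensor B x) = f.lTensor B (eN x) := by
    induction x with
    | zero => simp
    | add x y hx hy => simp only [map_add, hx, hy]
    | tmul b y =>
      induction y with
      | zero => simp
      | add x y hx hy => simp only [tmul_add, map_add, hx, hy]
      | tmul a n => simp [eM, eN]
  refine Function.Injective.of_comp (f := eM) ?_
  rw [show eM ∘ (f.baseChange A).lTensor B = f.lTensor B ∘ eN from funext comm]
  exact hf.comp eN.injective

/-- Injectivity of `f ⊗ Q` only depends on `Q` up to linear equivalence. -/
theorem lTensor_injective_of_linearEquiv {R M N Q Q' : Type*} [CommRing R]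
    [AddCommGroup M] [Module R M] [AddCommGroup N] [Module R N] [AddCommGroup Q] [Module R Q]
    [AddCommGroup Q'] [Module R Q'] (e : Q ≃ₗ[R] Q') (f : N →ₗ[R] M)
    (hf : Function.Injective (f.lTensor Q)) : Function.Injective (f.lTensor Q') := by
  refine Function.Injective.of_comp_right (g := e.rTensor N) ?_ (e.rTensor N).surjective
  have comm : f.lTensor Q' ∘ e.rTensor N = e.rTensor M ∘ f.lTensor Q :=
    congrArg DFunLike.coe ((LinearMap.lTensor_comp_rTensor _ e.toLinearMap f).trans
      (LinearMap.rTensor_comp_lTensor _ e.toLinearMap f).symm)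
  rw [comm]
  exact (e.rTensor M).injective.comp hf

/-- A submodule `N` of a finite free module over a noetherian ring has projective quotient if
`N ⊗ R/𝔪 → M ⊗ R/𝔪` is injective for all maximal ideals `𝔪`. -/
theorem projective_quotient_of_rTensor_injective {R M : Type*} [CommRing R] [IsNoetherianRing R]
    [AddCommGroup M] [Module R M] [Module.Free R M] [Module.Finite R M] (N : Submodule R M)
    (h : ∀ 𝔪 : Ideal R, 𝔪.IsMaximal →
      Function.Injective (LinearMap.rTensor (R ⧸ 𝔪) N.subtype)) :
    Module.Projective R (M ⧸ N) := by
  have : Module.FinitePresentation R (M ⧸ N) := Module.finitePresentation_of_finite R _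
  refine Module.projective_of_localization_maximal' (fun 𝔪 _ ↦ Localization.AtPrime 𝔪)
    (fun 𝔪 _ ↦ TensorProduct R (Localization.AtPrime 𝔪) (M ⧸ N))
    (fun 𝔪 _ ↦ TensorProduct.mk R (Localization.AtPrime 𝔪) (M ⧸ N) 1) fun 𝔪 h𝔪 ↦ ?_
  let e : (R ⧸ 𝔪) ≃ₗ[R] 𝔪.ResidueField :=
    LinearEquiv.ofBijective (IsScalarTower.toAlgHom R (R ⧸ 𝔪) 𝔪.ResidueField).toLinearMap
      𝔪.bijective_algebraMap_quotient_residueField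
  have inj : Function.Injective
      ((N.subtype.baseChange (Localization.AtPrime 𝔪)).lTensor 𝔪.ResidueField) :=
    lTensor_baseChange_injective _ _ _ <| lTensor_injective_of_linearEquiv e _ <|
      (LinearMap.lTensor_inj_iff_rTensor_inj _ _).mpr (h 𝔪 h𝔪)
  have := Module.free_of_lTensor_residueField_injective
    (N.subtype.baseChange (Localization.AtPrime 𝔪)) (N.mkQ.baseChange (Localization.AtPrime 𝔪))
    (LinearMap.lTensor_surjective _ N.mkQ_surjective)
    (lTensor_exact _ (LinearMap.exact_subtype_mkQ N) N.mkQ_surjective) inj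
  infer_instance

/-- Let `R` be a commutative noetherian ring, `M` a finite free `R`-module,
and `N ⊆ M` a submodule. Then `N` is a direct summand of `M` if and only if for every maximal
ideal `𝔪` of `R` the induced map `N ⊗ R/𝔪 → M ⊗ R/𝔪` is injective. -/
theorem flatness_stmt_5 (R : Type*) [CommRing R] [IsNoetherianRing R]
    (M : Type*) [AddCommGroup M] [Module R M] [Module.Free R M] [Module.Finite R M]
    (N : Submodule R M) :
    (∃ N' : Submodule R M, IsCompl N N') ↔
      ∀ 𝔪 : Ideal R, 𝔪.IsMaximal →
        Function.Injective (LinearMap.rTensor (R ⧸ 𝔪) N.subtype) := by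
  constructor
  · rintro ⟨N', hN⟩ 𝔪 -
    refine Function.LeftInverse.injective
      (g := (N.projectionOnto N' hN).rTensor (R ⧸ 𝔪)) fun x ↦ ?_
    rw [← LinearMap.comp_apply, ← LinearMap.rTensor_comp, Submodule.projectionOnto_comp_subtype,
      LinearMap.rTensor_id_apply]
  · intro h
    have := projective_quotient_of_rTensor_injective N h
    obtain ⟨s, hs⟩ := N.mkQ.exists_rightInverse_of_surjective N.range_mkQ
    have hs' (y : M ⧸ N) : N.mkQ (s y) = y := LinearMap.congr_fun hs y
    refine ⟨LinearMap.range s, Submodule.disjoint_def.mpr ?_, ?_⟩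
    · rintro _ hx ⟨y, rfl⟩
      rw [← hs' y, N.mkQ_apply, (Submodule.Quotient.mk_eq_zero N).mpr hx, map_zero]
    · refine codisjoint_iff.mpr <| Submodule.eq_top_iff'.mpr fun x ↦ Submodule.mem_sup.mpr
        ⟨x - s (N.mkQ x), ?_, s (N.mkQ x), ⟨_, rfl⟩, sub_add_cancel _ _⟩
      rw [← Submodule.Quotient.mk_eq_zero, ← N.mkQ_apply, map_sub, hs', sub_self]
end

section
/- Let K be a field, V a K-vector space of finite dimension n, and let (F_i)_{0≤i≤n} and (G_j)_{0≤j≤n} be two complete flags in V. Then there exists a unique permutation π ∈ S_n such that dim_K(F_i ∩ G_j) = #{k ∈ {1,...,n} : k ≤ i and π(k) ≤ j} for all 0 ≤ i, j ≤ n. Equivalently, π(i) is the unique index j such that the subquotient (F_i ∩ G_j)/(F_{i−1} ∩ G_j + F_i ∩ G_{j−1}) is nonzero. -/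
theorem exists_eq_ite_of_monotone_fin {n : ℕ} {d : Fin (n + 1) → ℕ} (hd : Monotone d)
    (h0 : d 0 = 0) (h1 : d (Fin.last n) = 1) :
    ∃ p : Fin n, ∀ j : Fin (n + 1), d j = if (p : ℕ) < (j : ℕ) then 1 else 0 := by
  have hex : ∃ m : ℕ, ∃ h : m < n + 1, d ⟨m, h⟩ = 1 := ⟨n, n.lt_succ_self, h1⟩
  classical
  obtain ⟨hm, hm1⟩ := Nat.find_spec hex
  have hmin : ∀ j : Fin (n + 1), (j : ℕ) < Nat.find hex → d j ≠ 1 :=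
    fun j hj h => Nat.find_min hex hj ⟨j.2, h⟩
  have hpos : Nat.find hex ≠ 0 := by
    intro h
    have : (⟨Nat.find hex, hm⟩ : Fin (n + 1)) = 0 := Fin.ext h
    rw [this, h0] at hm1
    exact zero_ne_one hm1
  generalize Nat.find hex = m at *
  refine ⟨⟨m - 1, by omega⟩, fun j => ?_⟩
  have hle : d j ≤ 1 := h1 ▸ hd (Fin.le_last j)
  split_ifs with hj
  · have hmj : (⟨m, hm⟩ : Fin (n + 1)) ≤ j := Fin.le_def.2 (by simp only at hj ⊢; omega)
    exact le_antisymm hle (hm1 ▸ hd hmj)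
  · have := hmin j (by simp only at hj; omega)
    omega

theorem card_filter_lt_succ_and {n : ℕ} (p : Fin n → Fin n) (i : Fin n) (j : ℕ) :
    (Finset.univ.filter fun k : Fin n => (k : ℕ) < (i : ℕ) + 1 ∧ (p k : ℕ) < j).card =
      (Finset.univ.filter fun k : Fin n => (k : ℕ) < (i : ℕ) ∧ (p k : ℕ) < j).card +
        if (p i : ℕ) < j then 1 else 0 := by
  simp only [Finset.card_filter]
  rw [← Finset.sum_ite_eq' Finset.univ i (fun k => if (p k : ℕ) < j then 1 else 0) |>.trans
    (if_pos (Finset.mem_univ i)), ← Finset.sum_add_distrib]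
  refine Finset.sum_congr rfl fun k _ => ?_
  grind

/-- The map `(i, j) ↦ dim (F i ⊓ G j)` is supermodular for increasing families `F` and `G`. -/
theorem finrank_inf_add_finrank_inf_le {K V ι κ : Type*} [DivisionRing K] [AddCommGroup V]
    [Module K V] [FiniteDimensional K V] [Preorder ι] [Preorder κ]
    {F : ι → Submodule K V} {G : κ → Submodule K V} (hF : Monotone F) (hG : Monotone G)
    {i i' : ι} {j j' : κ} (hi : i ≤ i') (hj : j ≤ j') :
    Module.finrank K ↥(F i' ⊓ G j) + Module.finrank K ↥(F i ⊓ G j') ≤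
      Module.finrank K ↥(F i' ⊓ G j') + Module.finrank K ↥(F i ⊓ G j) := by
  rw [← Submodule.finrank_sup_add_finrank_inf_eq]
  gcongr ?_ + ?_
  · exact Submodule.finrank_mono
      (sup_le (inf_le_inf le_rfl (hG hj)) (inf_le_inf (hF hi) le_rfl))
  · exact Submodule.finrank_mono
      (le_inf (inf_le_right.trans inf_le_left) (inf_le_left.trans inf_le_right))


/-- Let `V` be an `n`-dimensional vector space over a field `K` and let
`(F_i)` and `(G_j)` be two complete flags in `V` (indexed by `0, …, n`, increasing, with
`dim F_i = i`). Then there is a unique permutation `π ∈ S_n` (written on `Fin n`, `0`-indexed)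
such that `dim (F_i ∩ G_j) = #{k : k ≤ i and π(k) ≤ j}` for all `i, j`. -/
theorem flatness_stmt_11 (K V : Type*) [Field K] [AddCommGroup V] [Module K V]
    [FiniteDimensional K V] (n : ℕ) (hdim : Module.finrank K V = n)
    (F G : Fin (n+1) → Submodule K V)
    (hF : Monotone F) (hFrank : ∀ i, Module.finrank K (F i) = (i : ℕ))
    (hG : Monotone G) (hGrank : ∀ i, Module.finrank K (G i) = (i : ℕ)) :
    ∃! π : Equiv.Perm (Fin n), ∀ i j : Fin (n+1),
      Module.finrank K ↥(F i ⊓ G j) =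
        (Finset.univ.filter fun k : Fin n =>
          (k : ℕ) < (i : ℕ) ∧ ((π k : Fin n) : ℕ) < (j : ℕ)).card := by
  have hFtop : F (Fin.last n) = ⊤ := Submodule.eq_top_of_finrank_eq (by rw [hFrank, hdim]; rfl)
  have hGtop : G (Fin.last n) = ⊤ := Submodule.eq_top_of_finrank_eq (by rw [hGrank, hdim]; rfl)
  have hFbot : F 0 = ⊥ := Submodule.finrank_eq_zero.1 (hFrank 0)
  have hGbot : G 0 = ⊥ := Submodule.finrank_eq_zero.1 (hGrank 0)
  have hstep : ∀ i : Fin n, ∃ p : Fin n, ∀ j : Fin (n + 1),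
      Module.finrank K ↥(F i.succ ⊓ G j) =
        Module.finrank K ↥(F i.castSucc ⊓ G j) + if (p : ℕ) < (j : ℕ) then 1 else 0 := by
    intro i
    have hi : i.castSucc ≤ i.succ := i.castSucc_lt_succ.le
    have hle : ∀ j, Module.finrank K ↥(F i.castSucc ⊓ G j) ≤ Module.finrank K ↥(F i.succ ⊓ G j) :=
      fun j => Submodule.finrank_mono (inf_le_inf (hF hi) le_rfl)
    obtain ⟨p, hp⟩ := exists_eq_ite_of_monotone_fin
      (d := fun j => Module.finrank K ↥(F i.succ ⊓ G j) -
        Module.finrank K ↥(F i.castSucc ⊓ G j))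
      (by
        intro j j' hj
        have := finrank_inf_add_finrank_inf_le hF hG hi hj
        have := hle j
        have := hle j'
        dsimp only
        omega)
      (by rw [hGbot, inf_bot_eq, inf_bot_eq, Nat.sub_self])
      (by rw [hGtop, inf_top_eq, inf_top_eq, hFrank, hFrank, Fin.val_succ, Fin.val_castSucc,
        Nat.add_sub_cancel_left])
    refine ⟨p, fun j => ?_⟩
    rw [← hp j, Nat.add_sub_cancel' (hle j)]
  choose p hp using hstep
  have hcount : ∀ i j : Fin (n + 1), Module.finrank K ↥(F i ⊓ G j) =
      (Finset.univ.filter fun k : Fin n => (k : ℕ) < (i : ℕ) ∧ (p k : ℕ) < (j : ℕ)).card := by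
    intro i j
    induction i using Fin.induction with
    | zero => rw [hFbot, bot_inf_eq, finrank_bot]; simp
    | succ i ih => rw [hp, ih, Fin.val_succ, card_filter_lt_succ_and, Fin.val_castSucc]
  have hsurj : Function.Surjective p := by
    intro m
    by_contra! hm
    have h1 := hcount (Fin.last n) m.castSucc
    have h2 := hcount (Fin.last n) m.succ
    rw [hFtop, top_inf_eq, hGrank] at h1 h2
    have heq : ∀ k, (p k : ℕ) < (m : ℕ) + 1 ↔ (p k : ℕ) < m := fun k => by
      have := Fin.val_ne_of_ne (hm k)
      omega
    simp only [Fin.val_succ, Fin.val_castSucc, heq] at h1 h2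
    omega
  refine ⟨Equiv.ofBijective p (Finite.surjective_iff_bijective.1 hsurj), hcount, fun σ hσ => ?_⟩
  ext i
  have hiff : ∀ j : Fin (n + 1), (σ i : ℕ) < j ↔ (p i : ℕ) < j := by
    intro j
    have h1 := hσ i.succ j
    rw [Fin.val_succ, card_filter_lt_succ_and σ i, hp, hσ i.castSucc j, Fin.val_castSucc] at h1
    grind
  have h1 := hiff (σ i).succ
  have h2 := hiff (p i).succ
  simp only [Fin.val_succ] at h1 h2
  simp only [Equiv.ofBijective_apply]
  omega
end
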